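/- arXiv:2306.06745 — 5 statements merged into one kernel-verified Lean document; each statement's English description precedes it below -/
import Mathlib

section
/- Let L be an algebraic frame, X_L its Priestley space, and Y_L the spatial part of X_L equipped with the topology generated by {U ∩ Y_L : U a clopen upset of X_L}. The following are equivalent: (1) L is a coherent frame; (2) X_L is kernel-stable and L-compact (ker X_L = X_L); (3) Y_L is a spectral space. -/
open Set Topology

/-- Clopen upsets of a topological space with a partial order. -/
def ClopUp (X : Type*) [TopologicalSpace X] [Preorder X] : Set (Set X) :=
  {U | IsClopen U ∧ IsUpperSet U}

/-- Downward closure of a set. -/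
def downClosure (X : Type*) [Preorder X] (A : Set X) : Set X := {x | ∃ y ∈ A, x ≤ y}

/-- Priestley space: compact, and clopen upsets separate points via the Priestley separation axiom. -/
def IsPriestley (X : Type*) [TopologicalSpace X] [Preorder X] : Prop :=
  CompactSpace X ∧ ∀ x y : X, ¬x ≤ y → ∃ U ∈ ClopUp X, x ∈ U ∧ y ∉ U

/-- Esakia space: a Priestley space in which downward closures of clopens are clopen. -/
def IsEsakia (X : Type*) [TopologicalSpace X] [Preorder X] : Prop :=
  IsPriestley X ∧ ∀ U : Set X, IsClopen U → IsClopen (downClosure X U)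

/-- L-space: an extremally order-disconnected Esakia space. -/
def IsLSpace (X : Type*) [TopologicalSpace X] [Preorder X] : Prop :=
  IsEsakia X ∧ ∀ U : Set X, IsOpen U → IsUpperSet U → IsOpen (closure U)

/-- The spatial part of an L-space: points with clopen downset. -/
def spatialPart (X : Type*) [TopologicalSpace X] [Preorder X] : Set X :=
  {y : X | IsClopen {x : X | x ≤ y}}

/-- Scott upset: a closed upset all of whose minimal points lie in the spatial part. -/
def IsScottUpset (X : Type*) [TopologicalSpace X] [Preorder X] (F : Set X) : Prop :=
  IsClosed F ∧ IsUpperSet F ∧ ∀ y ∈ F, (∀ z ∈ F, z ≤ y → z = y) → y ∈ spatialPart X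

/-- Clopen Scott upsets. -/
def ClopSUp (X : Type*) [TopologicalSpace X] [Preorder X] : Set (Set X) :=
  {U | IsClopen U ∧ IsScottUpset X U}

/-- Clopen bisets (both upsets and downsets). -/
def ClopBi (X : Type*) [TopologicalSpace X] [Preorder X] : Set (Set X) :=
  {U | IsClopen U ∧ IsUpperSet U ∧ IsLowerSet U}

/-- `V ≪ U` for clopen upsets: every open upset whose closure contains `U` contains `V`. -/
def wayBelowSet (X : Type*) [TopologicalSpace X] [Preorder X] (V U : Set X) : Prop :=
  ∀ W : Set X, IsOpen W → IsUpperSet W → U ⊆ closure W → V ⊆ W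

/-- The kernel of a clopen upset. -/
def kerSet (X : Type*) [TopologicalSpace X] [Preorder X] (U : Set X) : Set X :=
  ⋃₀ {V | V ∈ ClopUp X ∧ wayBelowSet X V U}

/-- The core of a clopen upset. -/
def coreSet (X : Type*) [TopologicalSpace X] [Preorder X] (U : Set X) : Set X :=
  ⋃₀ {V | V ∈ ClopSUp X ∧ V ⊆ U}

/-- The regular part of a clopen upset. -/
def regSet (X : Type*) [TopologicalSpace X] [Preorder X] (U : Set X) : Set X :=
  ⋃₀ {V | V ∈ ClopUp X ∧ downClosure X V ⊆ U}

/-- The center of a clopen upset. -/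
def cenSet (X : Type*) [TopologicalSpace X] [Preorder X] (U : Set X) : Set X :=
  ⋃₀ {V | V ∈ ClopBi X ∧ V ⊆ U}

/-- The topology on the spatial part, generated by traces of clopen upsets. -/
def spatialTop (X : Type*) [TopologicalSpace X] [Preorder X] :
    TopologicalSpace (spatialPart X) :=
  TopologicalSpace.generateFrom
    {V : Set (spatialPart X) | ∃ U ∈ ClopUp X, V = ((↑) : spatialPart X → X) ⁻¹' U}

/-- An algebraic L-space: the core of every clopen upset is dense in it. -/
def IsAlgebraicLSpace (X : Type*) [TopologicalSpace X] [Preorder X] : Prop :=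
  IsLSpace X ∧ ∀ U ∈ ClopUp X, U ⊆ closure (coreSet X U)

/-- A space is compactly based if compact open sets form a basis. -/
def CompactlyBased (Y : Type*) [TopologicalSpace Y] : Prop :=
  ∀ V : Set Y, IsOpen V → ∀ y ∈ V, ∃ K : Set Y, IsOpen K ∧ IsCompact K ∧ y ∈ K ∧ K ⊆ V

/-- A set is saturated if it is the intersection of the open sets containing it. -/
def IsSaturatedSet {Y : Type*} [TopologicalSpace Y] (K : Set Y) : Prop :=
  K = ⋂₀ {U : Set Y | IsOpen U ∧ K ⊆ U}

/-- The way-below relation in a frame. -/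
def frameWayBelow {L : Type*} [Order.Frame L] (a b : L) : Prop :=
  ∀ S : Set L, b ≤ sSup S → ∃ T : Set L, T ⊆ S ∧ T.Finite ∧ a ≤ sSup T

/-- A compact element of a frame. -/
def IsCompactElt {L : Type*} [Order.Frame L] (a : L) : Prop := frameWayBelow a a

/-- An algebraic frame: every element is the join of the compact elements below it. -/
def AlgebraicFrame (L : Type*) [Order.Frame L] : Prop :=
  ∀ a : L, a = sSup {k : L | IsCompactElt k ∧ k ≤ a}

/-- An arithmetic frame: algebraic with stable way-below relation. -/
def ArithmeticFrame (L : Type*) [Order.Frame L] : Prop :=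
  AlgebraicFrame L ∧
    ∀ a b c : L, frameWayBelow a b → frameWayBelow a c → frameWayBelow a (b ⊓ c)

/-- A coherent frame: arithmetic and compact. -/
def CoherentFrame (L : Type*) [Order.Frame L] : Prop :=
  ArithmeticFrame L ∧ IsCompactElt (⊤ : L)

/-- A prime filter of a frame. -/
def IsPrimeFilter {L : Type*} [Order.Frame L] (F : Set L) : Prop :=
  F.Nonempty ∧ F ≠ Set.univ ∧ (∀ a ∈ F, ∀ b : L, a ≤ b → b ∈ F) ∧
    (∀ a ∈ F, ∀ b ∈ F, a ⊓ b ∈ F) ∧ ∀ a b : L, a ⊔ b ∈ F → a ∈ F ∨ b ∈ F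

/-- A completely prime filter of a frame. -/
def IsCompletelyPrimeFilter {L : Type*} [Order.Frame L] (F : Set L) : Prop :=
  F.Nonempty ∧ F ≠ Set.univ ∧ (∀ a ∈ F, ∀ b : L, a ≤ b → b ∈ F) ∧
    (∀ a ∈ F, ∀ b ∈ F, a ⊓ b ∈ F) ∧ ∀ S : Set L, sSup S ∈ F → ∃ s ∈ S, s ∈ F

/-- The Priestley space of a frame: prime filters ordered by inclusion. -/
abbrev PriestleyDual (L : Type*) [Order.Frame L] : Type _ := {F : Set L // IsPrimeFilter F}

/-- The Priestley topology on the Priestley space of a frame. -/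
instance PriestleyDual.instTopologicalSpace (L : Type*) [Order.Frame L] :
    TopologicalSpace (PriestleyDual L) :=
  TopologicalSpace.generateFrom
    ({S : Set (PriestleyDual L) | ∃ a : L, S = {x | a ∈ x.val}} ∪
     {S : Set (PriestleyDual L) | ∃ a : L, S = {x | a ∈ x.val}ᶜ})


section PrimeFilters

variable {L : Type*} [Order.Frame L]

namespace IsPrimeFilter

variable {F : Set L}

lemma mem_of_le (hF : IsPrimeFilter F) {a b : L} (ha : a ∈ F) (hab : a ≤ b) : b ∈ F :=
  hF.2.2.1 a ha b hab

lemma top_mem (hF : IsPrimeFilter F) : ⊤ ∈ F :=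
  let ⟨_, ha⟩ := hF.1
  hF.mem_of_le ha le_top

lemma bot_notMem (hF : IsPrimeFilter F) : ⊥ ∉ F := fun h =>
  hF.2.1 (eq_univ_of_forall fun _ => hF.mem_of_le h bot_le)

lemma inf_mem_iff (hF : IsPrimeFilter F) {a b : L} : a ⊓ b ∈ F ↔ a ∈ F ∧ b ∈ F :=
  ⟨fun h => ⟨hF.mem_of_le h inf_le_left, hF.mem_of_le h inf_le_right⟩,
    fun h => hF.2.2.2.1 a h.1 b h.2⟩

lemma sup_mem_iff (hF : IsPrimeFilter F) {a b : L} : a ⊔ b ∈ F ↔ a ∈ F ∨ b ∈ F :=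
  ⟨hF.2.2.2.2 a b,
    fun h => h.elim (fun h => hF.mem_of_le h le_sup_left) fun h => hF.mem_of_le h le_sup_right⟩

lemma sSup_mem_iff_of_finite (hF : IsPrimeFilter F) {T : Set L} (hT : T.Finite) :
    sSup T ∈ F ↔ ∃ t ∈ T, t ∈ F := by
  induction T, hT using Set.Finite.induction_on with
  | empty => simpa using hF.bot_notMem
  | insert _ _ ih => rw [sSup_insert, hF.sup_mem_iff, ih]; simp

end IsPrimeFilter

lemma IsCompletelyPrimeFilter.isPrimeFilter {F : Set L} (hF : IsCompletelyPrimeFilter F) :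
    IsPrimeFilter F := by
  refine ⟨hF.1, hF.2.1, hF.2.2.1, hF.2.2.2.1, fun a b hab => ?_⟩
  simpa using hF.2.2.2.2 {a, b} (by rwa [sSup_pair])

/-- The complement of the principal ideal of a meet-prime element is a completely prime filter. -/
lemma isCompletelyPrimeFilter_compl_Iic {c : L} (hc : c ≠ ⊤)
    (hprime : ∀ a b : L, a ⊓ b ≤ c → a ≤ c ∨ b ≤ c) : IsCompletelyPrimeFilter {a | ¬ a ≤ c} := by
  refine ⟨⟨⊤, by simpa using hc⟩, fun h => ?_, fun a ha b hab hb => ha (hab.trans hb),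
    fun a ha b hb hab => (hprime a b hab).elim ha hb, fun S hS => ?_⟩
  · have : (⊥ : L) ∈ {a | ¬ a ≤ c} := h ▸ mem_univ _
    exact this bot_le
  · by_contra! h
    exact hS (sSup_le fun s hs => not_not.1 (h s hs))

lemma exists_isPrimeFilter {a b : L} (hab : ¬ a ≤ b) :
    ∃ F : Set L, IsPrimeFilter F ∧ a ∈ F ∧ b ∉ F := by
  obtain ⟨J, hJ, hbJ, haJ⟩ := DistribLattice.prime_ideal_of_disjoint_filter_ideal
    (F := Order.PFilter.principal a) (I := Order.Ideal.principal b)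
    (disjoint_left.2 fun x hax hxb => hab (le_trans hax hxb))
  have ha : a ∉ J := disjoint_left.1 haJ (Order.PFilter.mem_principal.2 le_rfl)
  have hb : b ∈ J := hbJ (Order.Ideal.mem_principal.2 le_rfl)
  refine ⟨{x | x ∉ J}, ⟨⟨a, ha⟩, fun h => ?_, fun x hx y hxy hy => hx (J.lower hxy hy),
    fun x hx y hy hxy => (hJ.mem_or_mem hxy).elim hx hy, fun x y hxy => ?_⟩, ha,
    fun h => h hb⟩
  · have : b ∈ {x | x ∉ J} := h ▸ mem_univ b
    exact this hb
  · by_contra! h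
    exact hxy (Order.Ideal.sup_mem (not_not.1 h.1) (not_not.1 h.2))

lemma frameWayBelow.mono {a a' b b' : L} (h : frameWayBelow a b) (ha : a' ≤ a) (hb : b ≤ b') :
    frameWayBelow a' b' := fun S hS =>
  let ⟨T, hTS, hT, haT⟩ := h S (hb.trans hS)
  ⟨T, hTS, hT, ha.trans haT⟩

lemma IsCompactElt.exists_maximal_not_le {k b : L} (hk : IsCompactElt k) (hkb : ¬ k ≤ b) :
    ∃ c, b ≤ c ∧ Maximal (fun x => ¬ k ≤ x) c := by
  refine zorn_le_nonempty₀ {x | ¬ k ≤ x} (fun C hC hchain y hy => ?_) b hkb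
  refine ⟨sSup C, fun hkC => ?_, fun z hz => le_sSup hz⟩
  obtain ⟨T, hTC, hT, hkT⟩ := hk C hkC
  obtain ⟨z, hz, hzT⟩ : ∃ z ∈ C, ∀ t ∈ T, t ≤ z := by
    clear hkT
    induction T, hT using Set.Finite.induction_on with
    | empty => exact ⟨y, hy, by simp⟩
    | @insert t T _ _ ih =>
      obtain ⟨z, hz, hzT⟩ := ih ((subset_insert t T).trans hTC)
      obtain ⟨w, hw, hzw, htw⟩ := hchain.directedOn z hz t (hTC (mem_insert t T))
      exact ⟨w, hw, forall_mem_insert.2 ⟨htw, fun u hu => (hzT u hu).trans hzw⟩⟩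
  exact hC hz (hkT.trans (sSup_le hzT))

/-- An algebraic frame is spatial. -/
lemma AlgebraicFrame.exists_isCompletelyPrimeFilter (halg : AlgebraicFrame L) {a b : L}
    (hab : ¬ a ≤ b) : ∃ F : Set L, IsCompletelyPrimeFilter F ∧ a ∈ F ∧ b ∉ F := by
  obtain ⟨k, hk, hka, hkb⟩ : ∃ k, IsCompactElt k ∧ k ≤ a ∧ ¬ k ≤ b := by
    by_contra! h
    exact hab ((halg a).le.trans (sSup_le fun k hk => h k hk.1 hk.2))
  obtain ⟨c, hbc, hc⟩ := hk.exists_maximal_not_le hkb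
  refine ⟨{x | ¬ x ≤ c}, isCompletelyPrimeFilter_compl_Iic ?_ fun x y hxy => ?_,
    fun hac => hc.prop (hka.trans hac), fun h => h hbc⟩
  · rintro rfl
    exact hc.prop le_top
  · by_contra! h
    have key : ∀ z, ¬ z ≤ c → k ≤ c ⊔ z := fun z hz => by
      by_contra hkz
      exact hz (le_sup_right.trans (hc.le_of_ge hkz le_sup_left))
    refine hc.prop ((le_inf (key x h.1) (key y h.2)).trans ?_)
    rw [← sup_inf_left]
    exact sup_le le_rfl hxy

end PrimeFilters

namespace PriestleyDual

variable {L : Type*} [Order.Frame L]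

/-- The set of prime filters containing a given element. -/
def basicSet (a : L) : Set (PriestleyDual L) := {x | a ∈ x.val}

@[simp] lemma mem_basicSet {a : L} {x : PriestleyDual L} : x ∈ basicSet a ↔ a ∈ x.val := Iff.rfl

lemma isUpperSet_basicSet (a : L) : IsUpperSet (basicSet a) := fun _ _ hxy hx => hxy hx

lemma isClopen_basicSet (a : L) : IsClopen (basicSet a) :=
  ⟨⟨TopologicalSpace.isOpen_generateFrom_of_mem (Or.inr ⟨a, rfl⟩)⟩,
    TopologicalSpace.isOpen_generateFrom_of_mem (Or.inl ⟨a, rfl⟩)⟩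

lemma basicSet_mem_clopUp (a : L) : basicSet a ∈ ClopUp (PriestleyDual L) :=
  ⟨isClopen_basicSet a, isUpperSet_basicSet a⟩

lemma basicSet_mono {a b : L} (h : a ≤ b) : basicSet a ⊆ basicSet b :=
  fun x hx => x.2.mem_of_le hx h

lemma basicSet_subset_iff {a b : L} : basicSet a ⊆ basicSet b ↔ a ≤ b := by
  refine ⟨fun h => ?_, basicSet_mono⟩
  by_contra hab
  obtain ⟨F, hF, ha, hb⟩ := exists_isPrimeFilter hab
  exact hb (h (show (⟨F, hF⟩ : PriestleyDual L) ∈ basicSet a from ha))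

lemma basicSet_inf (a b : L) : basicSet (a ⊓ b) = basicSet a ∩ basicSet b :=
  ext fun x => x.2.inf_mem_iff

lemma basicSet_top : basicSet (⊤ : L) = univ := eq_univ_of_forall fun x => x.2.top_mem

lemma basicSet_bot : basicSet (⊥ : L) = ∅ := eq_empty_of_forall_notMem fun x => x.2.bot_notMem

lemma basicSet_sup (a b : L) : basicSet (a ⊔ b) = basicSet a ∪ basicSet b :=
  ext fun x => x.2.sup_mem_iff

lemma basicSet_sSup_of_finite {T : Set L} (hT : T.Finite) :
    basicSet (sSup T) = ⋃ t ∈ T, basicSet t := by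
  ext x
  simp [x.2.sSup_mem_iff_of_finite hT]

lemma isTopologicalBasis_basicSet_diff :
    TopologicalSpace.IsTopologicalBasis
      {S : Set (PriestleyDual L) | ∃ b c : L, S = basicSet b \ basicSet c} where
  exists_subset_inter := by
    rintro _ ⟨b, c, rfl⟩ _ ⟨b', c', rfl⟩ x hx
    have h : basicSet (b ⊓ b') \ basicSet (c ⊔ c') =
        (basicSet b \ basicSet c) ∩ (basicSet b' \ basicSet c') := by
      rw [basicSet_inf, basicSet_sup]
      ext
      simp
      tauto
    exact ⟨_, ⟨_, _, rfl⟩, h ▸ hx, h.subset⟩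
  sUnion_eq := by
    refine eq_univ_of_forall fun x => ⟨basicSet ⊤ \ basicSet ⊥, ⟨_, _, rfl⟩, ?_⟩
    simp [basicSet_top, basicSet_bot]
  eq_generateFrom := by
    refine le_antisymm (le_generateFrom ?_) (le_generateFrom ?_)
    · rintro _ ⟨b, c, rfl⟩
      exact (isClopen_basicSet b).isOpen.sdiff (isClopen_basicSet c).isClosed
    · rintro _ (⟨a, rfl⟩ | ⟨a, rfl⟩)
      · refine TopologicalSpace.isOpen_generateFrom_of_mem ⟨a, ⊥, ?_⟩
        rw [basicSet_bot, sdiff_empty, basicSet]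
      · refine TopologicalSpace.isOpen_generateFrom_of_mem ⟨⊤, a, ?_⟩
        rw [basicSet_top, ← compl_eq_univ_sdiff, basicSet]

instance : CompactSpace (PriestleyDual L) where
  isCompact_univ := by
    rw [isCompact_iff_ultrafilter_le_nhds]
    intro f _
    have hF : IsPrimeFilter {a : L | basicSet a ∈ f} := by
      refine ⟨⟨⊤, ?_⟩, fun h => ?_, fun a ha b hab => Filter.mem_of_superset ha (basicSet_mono hab),
        fun a ha b hb => ?_, fun a b hab => ?_⟩
      · rw [mem_ofPred_eq, basicSet_top]
        exact Filter.univ_mem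
      · have hbot : (⊥ : L) ∈ {a : L | basicSet a ∈ f} := h ▸ mem_univ _
        rw [mem_ofPred_eq, basicSet_bot] at hbot
        exact f.empty_notMem hbot
      · rw [mem_ofPred_eq, basicSet_inf]
        exact Filter.inter_mem ha hb
      · rw [mem_ofPred_eq, basicSet_sup] at hab
        exact Ultrafilter.union_mem_iff.1 hab
    refine ⟨⟨_, hF⟩, mem_univ _, ?_⟩
    rw [isTopologicalBasis_basicSet_diff.nhds_hasBasis.ge_iff]
    rintro _ ⟨⟨b, c, rfl⟩, hb, hc⟩
    exact Filter.inter_mem hb (Ultrafilter.compl_mem_iff_notMem.2 hc)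

lemma exists_basicSet_subset {W : Set (PriestleyDual L)} (hW : IsOpen W) (hup : IsUpperSet W)
    {x : PriestleyDual L} (hx : x ∈ W) : ∃ a ∈ x.val, basicSet a ⊆ W := by
  have hcover : Wᶜ ⊆ ⋃ s : x.val, (basicSet (s : L))ᶜ := fun y hy => by
    have hxy : ¬ x ≤ y := fun h => hy (hup h hx)
    obtain ⟨s, hs, hsy⟩ := not_subset.1 hxy
    exact mem_iUnion.2 ⟨⟨s, hs⟩, hsy⟩
  obtain ⟨t, ht⟩ := hW.isClosed_compl.isCompact.elim_finite_subcover _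
    (fun s : x.val => (isClopen_basicSet (s : L)).compl.isOpen) hcover
  refine ⟨t.inf (↑), ?_, fun y hy => ?_⟩
  · exact Finset.inf_induction x.2.top_mem (fun a ha b hb => x.2.2.2.2.1 a ha b hb)
      fun s _ => s.2
  · by_contra hyW
    obtain ⟨s, hs, hsy⟩ := mem_iUnion₂.1 (ht hyW)
    exact hsy (y.2.mem_of_le hy (Finset.inf_le hs))

lemma eq_iUnion_basicSet {W : Set (PriestleyDual L)} (hW : IsOpen W) (hup : IsUpperSet W) :
    W = ⋃ s ∈ {s : L | basicSet s ⊆ W}, basicSet s := by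
  refine subset_antisymm (fun x hx => ?_) (iUnion₂_subset fun _ h => h)
  obtain ⟨a, hax, haW⟩ := exists_basicSet_subset hW hup hx
  exact mem_biUnion (show a ∈ {s : L | basicSet s ⊆ W} from haW) hax

lemma exists_finite_subset_basicSet {K : Set (PriestleyDual L)} (hK : IsCompact K) {S : Set L}
    (hKS : K ⊆ ⋃ s ∈ S, basicSet s) : ∃ T ⊆ S, T.Finite ∧ K ⊆ basicSet (sSup T) := by
  obtain ⟨T, hTS, hT, hKT⟩ :=
    hK.elim_finite_subcover_image (fun s _ => (isClopen_basicSet s).isOpen) hKS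
  exact ⟨T, hTS, hT, by rwa [basicSet_sSup_of_finite hT]⟩

lemma exists_eq_basicSet {U : Set (PriestleyDual L)} (hU : U ∈ ClopUp (PriestleyDual L)) :
    ∃ a : L, U = basicSet a := by
  obtain ⟨T, hTS, hT, hUT⟩ := exists_finite_subset_basicSet hU.1.isClosed.isCompact
    (eq_iUnion_basicSet hU.1.isOpen hU.2).subset
  refine ⟨sSup T, hUT.antisymm ?_⟩
  rw [basicSet_sSup_of_finite hT]
  exact iUnion₂_subset fun _ h => hTS h

lemma closure_iUnion_basicSet (S : Set L) :
    closure (⋃ s ∈ S, basicSet s) = basicSet (sSup S) := by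
  refine (closure_minimal (iUnion₂_subset fun s hs => basicSet_mono (le_sSup hs))
    (isClopen_basicSet _).isClosed).antisymm fun x hx => ?_
  rw [isTopologicalBasis_basicSet_diff.mem_closure_iff]
  rintro _ ⟨b, c, rfl⟩ ⟨hb, hc⟩
  by_contra! hempty
  have hne : ¬ b ⊓ sSup S ≤ c := fun h => hc (x.2.mem_of_le (x.2.inf_mem_iff.2 ⟨hb, hx⟩) h)
  refine hne ?_
  rw [inf_sSup_eq, iSup₂_le_iff]
  intro s hs
  rw [← basicSet_subset_iff, basicSet_inf]
  intro y hy
  by_contra hyc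
  exact hempty.le ⟨⟨hy.1, hyc⟩, mem_biUnion hs hy.2⟩

lemma wayBelowSet_basicSet_iff {a b : L} :
    wayBelowSet (PriestleyDual L) (basicSet b) (basicSet a) ↔ frameWayBelow b a := by
  constructor
  · intro h S haS
    obtain ⟨T, hTS, hT, hbT⟩ := exists_finite_subset_basicSet
      (isClopen_basicSet b).isClosed.isCompact
      (h (⋃ s ∈ S, basicSet s) (isOpen_biUnion fun s _ => (isClopen_basicSet s).isOpen)
        (isUpperSet_iUnion₂ fun s _ => isUpperSet_basicSet s)
        (by rw [closure_iUnion_basicSet]; exact basicSet_mono haS))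
    exact ⟨T, hTS, hT, basicSet_subset_iff.1 hbT⟩
  · intro h W hW hup haW
    rw [eq_iUnion_basicSet hW hup, closure_iUnion_basicSet, basicSet_subset_iff] at haW
    obtain ⟨T, hTW, hT, hbT⟩ := h _ haW
    refine (basicSet_mono hbT).trans ?_
    rw [basicSet_sSup_of_finite hT]
    exact iUnion₂_subset fun _ ht => hTW ht

lemma mem_kerSet_basicSet {a : L} {x : PriestleyDual L} :
    x ∈ kerSet (PriestleyDual L) (basicSet a) ↔ ∃ b ∈ x.val, frameWayBelow b a := by
  constructor
  · rintro ⟨V, ⟨hV, hVa⟩, hx⟩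
    obtain ⟨b, rfl⟩ := exists_eq_basicSet hV
    exact ⟨b, hx, wayBelowSet_basicSet_iff.1 hVa⟩
  · rintro ⟨b, hb, hba⟩
    exact ⟨basicSet b, ⟨basicSet_mem_clopUp b, wayBelowSet_basicSet_iff.2 hba⟩, hb⟩

lemma basicSet_subset_kerSet_iff {a b : L} :
    basicSet b ⊆ kerSet (PriestleyDual L) (basicSet a) ↔ frameWayBelow b a := by
  refine ⟨fun h => wayBelowSet_basicSet_iff.1 fun W hW hup haW => h.trans ?_,
    fun h x hx => mem_kerSet_basicSet.2 ⟨b, hx, h⟩⟩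
  exact sUnion_subset fun V hV => hV.2 W hW hup haW

lemma kerSet_inter_eq_iff {a b : L} :
    kerSet (PriestleyDual L) (basicSet a ∩ basicSet b) =
        kerSet (PriestleyDual L) (basicSet a) ∩ kerSet (PriestleyDual L) (basicSet b) ↔
      ∀ c, frameWayBelow c a → frameWayBelow c b → frameWayBelow c (a ⊓ b) := by
  rw [← basicSet_inf]
  constructor
  · intro h c hca hcb
    rw [← basicSet_subset_kerSet_iff, h]
    exact subset_inter (basicSet_subset_kerSet_iff.2 hca) (basicSet_subset_kerSet_iff.2 hcb)
  · intro h
    ext x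
    simp only [mem_inter_iff, mem_kerSet_basicSet]
    constructor
    · rintro ⟨c, hc, hcab⟩
      exact ⟨⟨c, hc, hcab.mono le_rfl inf_le_left⟩, ⟨c, hc, hcab.mono le_rfl inf_le_right⟩⟩
    · rintro ⟨⟨c, hc, hca⟩, ⟨d, hd, hdb⟩⟩
      exact ⟨c ⊓ d, x.2.inf_mem_iff.2 ⟨hc, hd⟩,
        h _ (hca.mono inf_le_left le_rfl) (hdb.mono inf_le_right le_rfl)⟩

lemma kerSet_univ_eq_iff :
    kerSet (PriestleyDual L) univ = univ ↔ IsCompactElt (⊤ : L) := by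
  rw [← univ_subset_iff, ← basicSet_top, basicSet_subset_kerSet_iff, IsCompactElt]

lemma mem_spatialPart_iff {y : PriestleyDual L} :
    y ∈ spatialPart (PriestleyDual L) ↔ IsCompletelyPrimeFilter y.val := by
  constructor
  · intro hy
    have hup : {x | x ≤ y}ᶜ ∈ ClopUp (PriestleyDual L) :=
      ⟨IsClopen.compl hy, (isLowerSet_Iic y).compl⟩
    obtain ⟨c, hc⟩ := exists_eq_basicSet hup
    have hle : ∀ x : PriestleyDual L, c ∉ x.val → x ≤ y := fun x hx => by
      by_contra hxy
      exact hx (hc.subset hxy)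
    have hcy : c ∉ y.val := fun h => hc.superset h (le_refl y)
    refine ⟨y.2.1, y.2.2.1, y.2.2.2.1, y.2.2.2.2.1, fun S hS => ?_⟩
    by_contra! hSy
    refine hcy (y.2.mem_of_le hS (sSup_le fun s hs => ?_))
    rw [← basicSet_subset_iff]
    intro x hx
    by_contra hcx
    exact hSy s hs (hle x hcx hx)
  · intro hy
    have hc : sSup {a | a ∉ y.val} ∉ y.val := fun h =>
      let ⟨_, hs, hsy⟩ := hy.2.2.2.2 _ h
      hs hsy
    have : {x | x ≤ y} = (basicSet (sSup {a | a ∉ y.val}))ᶜ := by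
      refine subset_antisymm (fun x hx hcx => hc (hx hcx)) fun x hx a ha => ?_
      by_contra hay
      exact hx (x.2.mem_of_le ha (le_sSup hay))
    rw [spatialPart, mem_ofPred_eq, this]
    exact (isClopen_basicSet _).compl

end PriestleyDual

namespace SpatialPart

open PriestleyDual

variable {L : Type*} [Order.Frame L]

attribute [local instance] spatialTop

/-- The trace on the spatial part of the clopen upset given by an element. -/
def traceSet (a : L) : Set (spatialPart (PriestleyDual L)) := (↑) ⁻¹' basicSet a

@[simp] lemma mem_traceSet {a : L} {y : spatialPart (PriestleyDual L)} :
    y ∈ traceSet a ↔ a ∈ y.val.val := Iff.rfl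

lemma traceSet_mono {a b : L} (h : a ≤ b) : traceSet a ⊆ traceSet b :=
  preimage_mono (basicSet_mono h)

lemma traceSet_top : traceSet (⊤ : L) = univ := by rw [traceSet, basicSet_top, preimage_univ]

lemma traceSet_inf (a b : L) : traceSet (a ⊓ b) = traceSet a ∩ traceSet b := by
  rw [traceSet, basicSet_inf, preimage_inter, traceSet, traceSet]

lemma traceSet_sSup (S : Set L) : traceSet (sSup S) = ⋃ s ∈ S, traceSet s := by
  ext y
  simp only [mem_iUnion₂, mem_traceSet, exists_prop]
  exact ⟨(mem_spatialPart_iff.1 y.2).2.2.2.2 S,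
    fun ⟨s, hs, hsy⟩ => y.1.2.mem_of_le hsy (le_sSup hs)⟩

lemma traceSet_subset_iff (halg : AlgebraicFrame L) {a b : L} :
    traceSet a ⊆ traceSet b ↔ a ≤ b := by
  refine ⟨fun h => ?_, traceSet_mono⟩
  by_contra hab
  obtain ⟨F, hF, ha, hb⟩ := halg.exists_isCompletelyPrimeFilter hab
  exact hb (@h ⟨⟨F, hF.isPrimeFilter⟩, mem_spatialPart_iff.2 hF⟩ ha)

lemma isOpen_iff {V : Set (spatialPart (PriestleyDual L))} :
    IsOpen V ↔ ∃ a : L, V = traceSet a := by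
  constructor
  · intro hV
    induction hV with
    | basic V hV =>
      obtain ⟨U, hU, rfl⟩ := hV
      obtain ⟨a, rfl⟩ := exists_eq_basicSet hU
      exact ⟨a, rfl⟩
    | univ => exact ⟨⊤, traceSet_top.symm⟩
    | inter V W _ _ hV hW =>
      obtain ⟨⟨a, rfl⟩, ⟨b, rfl⟩⟩ := And.intro hV hW
      exact ⟨a ⊓ b, (traceSet_inf a b).symm⟩
    | sUnion 𝒱 _ h𝒱 =>
      refine ⟨sSup {a | traceSet a ∈ 𝒱}, ?_⟩
      rw [traceSet_sSup]
      refine subset_antisymm (sUnion_subset fun V hV => ?_)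
        (iUnion₂_subset fun a ha => subset_sUnion_of_mem ha)
      obtain ⟨a, rfl⟩ := h𝒱 V hV
      exact subset_biUnion_of_mem (u := traceSet) (show a ∈ {a | traceSet a ∈ 𝒱} from hV)
  · rintro ⟨a, rfl⟩
    exact TopologicalSpace.isOpen_generateFrom_of_mem ⟨_, basicSet_mem_clopUp a, rfl⟩

lemma isOpen_traceSet (a : L) : IsOpen (traceSet a) := isOpen_iff.2 ⟨a, rfl⟩

lemma isCompact_traceSet_iff (halg : AlgebraicFrame L) {a : L} :
    IsCompact (traceSet a) ↔ IsCompactElt a := by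
  constructor
  · intro ha S haS
    obtain ⟨T, hTS, hT, haT⟩ := ha.elim_finite_subcover_image (fun s _ => isOpen_traceSet s)
      ((traceSet_mono haS).trans (traceSet_sSup S).subset)
    rw [← traceSet_sSup, traceSet_subset_iff halg] at haT
    exact ⟨T, hTS, hT, haT⟩
  · intro ha
    refine isCompact_of_finite_subcover fun {ι} U hU haU => ?_
    choose c hc using fun i => isOpen_iff.1 (hU i)
    obtain rfl : U = fun i => traceSet (c i) := funext hc
    rw [← biUnion_range (f := c) (g := traceSet), ← traceSet_sSup, traceSet_subset_iff halg,
      ← image_univ] at haU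
    obtain ⟨T, -, hT, haT⟩ := exists_subset_image_finite_and.1 (ha _ haU)
    refine ⟨hT.toFinset, (traceSet_mono haT).trans ?_⟩
    rw [traceSet_sSup, biUnion_image]
    simp

lemma isCompactElt_sSup_of_finite (halg : AlgebraicFrame L) {T : Set L} (hT : T.Finite)
    (h : ∀ t ∈ T, IsCompactElt t) : IsCompactElt (sSup T) := by
  rw [← isCompact_traceSet_iff halg, traceSet_sSup]
  exact hT.isCompact_biUnion fun t ht => (isCompact_traceSet_iff halg).2 (h t ht)

lemma exists_isCompactElt_between (halg : AlgebraicFrame L) {a b : L} (h : frameWayBelow b a) :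
    ∃ k, IsCompactElt k ∧ b ≤ k ∧ k ≤ a := by
  obtain ⟨T, hTa, hT, hbT⟩ := h _ (halg a).le
  exact ⟨sSup T, isCompactElt_sSup_of_finite halg hT fun t ht => (hTa ht).1, hbT,
    sSup_le fun t ht => (hTa ht).2⟩

lemma compactSpace_iff (halg : AlgebraicFrame L) :
    CompactSpace (spatialPart (PriestleyDual L)) ↔ IsCompactElt (⊤ : L) := by
  rw [← isCompact_univ_iff, ← traceSet_top, isCompact_traceSet_iff halg]

lemma compactlyBased (halg : AlgebraicFrame L) :
    CompactlyBased (spatialPart (PriestleyDual L)) := by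
  intro V hV y hy
  obtain ⟨a, rfl⟩ := isOpen_iff.1 hV
  rw [halg a, traceSet_sSup] at hy
  obtain ⟨k, ⟨hk, hka⟩, hky⟩ := mem_iUnion₂.1 hy
  exact ⟨traceSet k, isOpen_traceSet k, (isCompact_traceSet_iff halg).2 hk, hky,
    traceSet_mono hka⟩

variable (L) in
lemma t0Space : T0Space (spatialPart (PriestleyDual L)) := by
  refine (t0Space_iff_inseparable _).2 fun x y hxy => Subtype.ext (Subtype.ext (ext fun a => ?_))
  exact hxy.mem_open_iff (isOpen_traceSet a)

variable (L) in
lemma quasiSober : QuasiSober (spatialPart (PriestleyDual L)) where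
  sober := by
    intro C hC hclosed
    obtain ⟨c, hc⟩ := isOpen_iff.1 hclosed.isOpen_compl
    have hmem : ∀ y, y ∈ C ↔ c ∉ y.val.val := fun y => by
      rw [← mem_traceSet, ← hc, notMem_compl_iff]
    have hF : IsCompletelyPrimeFilter {a : L | (C ∩ traceSet a).Nonempty} := by
      refine ⟨⟨⊤, ?_⟩, fun h => ?_,
        fun a ha b hab => ha.mono (inter_subset_inter_right C (traceSet_mono hab)),
        fun a ha b hb => ?_, fun S hS => ?_⟩
      · rw [mem_ofPred_eq, traceSet_top, inter_univ]
        exact hC.nonempty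
      · obtain ⟨y, -, hy⟩ : (⊥ : L) ∈ {a : L | (C ∩ traceSet a).Nonempty} := h ▸ mem_univ _
        exact y.1.2.bot_notMem hy
      · rw [mem_ofPred_eq, traceSet_inf]
        exact hC.isPreirreducible _ _ (isOpen_traceSet a) (isOpen_traceSet b) ha hb
      · obtain ⟨y, hyC, hy⟩ := hS
        rw [traceSet_sSup] at hy
        obtain ⟨s, hs, hsy⟩ := mem_iUnion₂.1 hy
        exact ⟨s, hs, y, hyC, hsy⟩
    have hcF : ¬ (C ∩ traceSet c).Nonempty := fun ⟨y, hyC, hy⟩ => (hmem y).1 hyC hy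
    obtain ⟨x, hx⟩ : ∃ x : spatialPart (PriestleyDual L),
        ∀ a, a ∈ x.val.val ↔ (C ∩ traceSet a).Nonempty :=
      ⟨⟨⟨_, hF.isPrimeFilter⟩, mem_spatialPart_iff.2 hF⟩, fun _ => Iff.rfl⟩
    have hxC : x ∈ C := (hmem x).2 fun h => hcF ((hx c).1 h)
    refine ⟨x, (isGenericPoint_iff_forall_closed hclosed hxC).2 fun Z hZ hxZ z hz => ?_⟩
    obtain ⟨a, ha⟩ := isOpen_iff.1 hZ.isOpen_compl
    by_contra hzZ
    exact ha.superset ((hx a).2 ⟨z, hz, ha.subset hzZ⟩) hxZ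

lemma forall_isCompact_inter_iff (halg : AlgebraicFrame L) :
    (∀ U V : Set (spatialPart (PriestleyDual L)), IsCompact U → IsOpen U → IsCompact V →
        IsOpen V → IsCompact (U ∩ V)) ↔
      ∀ a b c : L, frameWayBelow a b → frameWayBelow a c → frameWayBelow a (b ⊓ c) := by
  constructor
  · intro h a b c hab hac
    obtain ⟨k, hk, hak, hkb⟩ := exists_isCompactElt_between halg hab
    obtain ⟨l, hl, hal, hlc⟩ := exists_isCompactElt_between halg hac
    have hkl := h _ _ ((isCompact_traceSet_iff halg).2 hk) (isOpen_traceSet k)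
      ((isCompact_traceSet_iff halg).2 hl) (isOpen_traceSet l)
    rw [← traceSet_inf, isCompact_traceSet_iff halg] at hkl
    exact frameWayBelow.mono hkl (le_inf hak hal) (inf_le_inf hkb hlc)
  · rintro h U V hUc hU hVc hV
    obtain ⟨⟨a, rfl⟩, ⟨b, rfl⟩⟩ := And.intro (isOpen_iff.1 hU) (isOpen_iff.1 hV)
    rw [isCompact_traceSet_iff halg] at hUc hVc
    rw [← traceSet_inf, isCompact_traceSet_iff halg]
    exact h _ _ _ (frameWayBelow.mono hUc inf_le_left le_rfl)
      (frameWayBelow.mono hVc inf_le_right le_rfl)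

end SpatialPart

/-- for an algebraic frame L, TFAE: L is coherent; its Priestley
space is kernel-stable and L-compact; the spatial part is a spectral space. -/
theorem stmt12 (L : Type*) [Order.Frame L] (halg : AlgebraicFrame L) :
    [CoherentFrame L,
      (∀ U ∈ ClopUp (PriestleyDual L), ∀ V ∈ ClopUp (PriestleyDual L),
          kerSet (PriestleyDual L) (U ∩ V) =
            kerSet (PriestleyDual L) U ∩ kerSet (PriestleyDual L) V) ∧
        kerSet (PriestleyDual L) Set.univ = Set.univ,
      @CompactSpace (spatialPart (PriestleyDual L)) (spatialTop (PriestleyDual L)) ∧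
        @CompactlyBased (spatialPart (PriestleyDual L)) (spatialTop (PriestleyDual L)) ∧
        @T0Space (spatialPart (PriestleyDual L)) (spatialTop (PriestleyDual L)) ∧
        @QuasiSober (spatialPart (PriestleyDual L)) (spatialTop (PriestleyDual L)) ∧
        ∀ U V : Set (spatialPart (PriestleyDual L)),
          @IsCompact _ (spatialTop (PriestleyDual L)) U →
          IsOpen[spatialTop (PriestleyDual L)] U →
          @IsCompact _ (spatialTop (PriestleyDual L)) V →
          IsOpen[spatialTop (PriestleyDual L)] V →
          @IsCompact _ (spatialTop (PriestleyDual L)) (U ∩ V)].TFAE := by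
  have kernel_stable_iff : (∀ U ∈ ClopUp (PriestleyDual L), ∀ V ∈ ClopUp (PriestleyDual L),
      kerSet (PriestleyDual L) (U ∩ V) =
        kerSet (PriestleyDual L) U ∩ kerSet (PriestleyDual L) V) ↔
      ∀ a b c : L, frameWayBelow a b → frameWayBelow a c → frameWayBelow a (b ⊓ c) := by
    constructor
    · intro h a b c
      exact PriestleyDual.kerSet_inter_eq_iff.1 (h _ (PriestleyDual.basicSet_mem_clopUp b) _
        (PriestleyDual.basicSet_mem_clopUp c)) a
    · intro h U hU V hV
      obtain ⟨a, rfl⟩ := PriestleyDual.exists_eq_basicSet hU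
      obtain ⟨b, rfl⟩ := PriestleyDual.exists_eq_basicSet hV
      exact PriestleyDual.kerSet_inter_eq_iff.2 fun c => h c a b
  rw [kernel_stable_iff, PriestleyDual.kerSet_univ_eq_iff, SpatialPart.compactSpace_iff halg]
  tfae_have 1 ↔ 2 := ⟨fun h => ⟨h.1.2, h.2⟩, fun h => ⟨⟨halg, h.1⟩, h.2⟩⟩
  tfae_have 2 → 3 := fun h => ⟨h.2, SpatialPart.compactlyBased halg, SpatialPart.t0Space L,
    SpatialPart.quasiSober L, (SpatialPart.forall_isCompact_inter_iff halg).2 h.1⟩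
  tfae_have 3 → 2 := fun h =>
    ⟨(SpatialPart.forall_isCompact_inter_iff halg).1 h.2.2.2.2, h.1⟩
  tfae_finish
end

section
/- Let X be a Stone L-space. Then the clopen Scott upsets of X are exactly the clopen bisets of X: ClopSUp(X) = ClopBi(X). -/
open Set Topology

theorem IsPriestley.isClosed_Iic {X : Type*} [TopologicalSpace X] [Preorder X]
    (hX : IsPriestley X) (x : X) : IsClosed (Iic x) := by
  refine ⟨isOpen_iff_forall_mem_open.2 fun z hz => ?_⟩
  obtain ⟨U, ⟨hU, hUp⟩, hzU, hxU⟩ := hX.2 z x hz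
  exact ⟨U, fun w hw hwx => hxU (hUp hwx hw), hU.isOpen, hzU⟩

/-- In a Priestley space, every point of a closed set lies above a minimal point of that set. -/
theorem IsPriestley.exists_minimal_le {X : Type*} [TopologicalSpace X] [PartialOrder X]
    (hX : IsPriestley X) {F : Set X} (hF : IsClosed F) {x : X} (hx : x ∈ F) :
    ∃ y ≤ x, Minimal (· ∈ F) y := by
  have := hX.1
  refine zorn_le_nonempty₀ (α := Xᵒᵈ) F (fun c hcF hc y hy => ?_) x hx
  have : Nonempty c := ⟨⟨y, hy⟩⟩
  obtain ⟨z, hz⟩ := IsCompact.nonempty_iInter_of_directed_nonempty_isCompact_isClosed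
    (fun w : c => Iic (OrderDual.ofDual w.1) ∩ F)
    (fun a b => by
      rcases hc.total a.2 b.2 with h | h
      · exact ⟨b, fun w hw => ⟨le_trans hw.1 h, hw.2⟩, subset_rfl⟩
      · exact ⟨a, subset_rfl, fun w hw => ⟨le_trans hw.1 h, hw.2⟩⟩)
    (fun w => ⟨w.1, le_rfl, hcF w.2⟩)
    (fun w => ((hX.isClosed_Iic _).inter hF).isCompact)
    (fun w => (hX.isClosed_Iic _).inter hF)
  rw [mem_iInter] at hz
  exact ⟨z, (hz ⟨y, hy⟩).2, fun w hw => (hz ⟨w, hw⟩).1⟩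

/-- Closed Scott upsets are compact with respect to closures of open upsets. -/
theorem IsScottUpset.subset_of_subset_closure {X : Type*} [TopologicalSpace X] [PartialOrder X]
    (hX : IsPriestley X) {F W : Set X} (hF : IsScottUpset X F) (hW : IsUpperSet W)
    (h : F ⊆ closure W) : F ⊆ W := by
  intro x hx
  obtain ⟨y, hyx, hy⟩ := hX.exists_minimal_le hF.1 hx
  have hyY : IsClopen {z | z ≤ y} := hF.2.2 y hy.prop fun z hz hzy => hy.eq_of_le hz hzy
  obtain ⟨z, hzy, hzW⟩ := mem_closure_iff.1 (h hy.prop) _ hyY.isOpen (le_refl y)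
  exact hW (hzy.trans hyx) hzW

/-- If the kernel of the whole space is everything, every dense open upset is everything. -/
theorem eq_univ_of_dense_of_kerSet_eq_univ {X : Type*} [TopologicalSpace X] [Preorder X]
    (hK : kerSet X univ = univ) {W : Set X} (hW : IsOpen W) (hWup : IsUpperSet W)
    (hd : Dense W) : W = univ := by
  refine univ_subset_iff.1 (hK.symm.subset.trans (sUnion_subset fun V hV => ?_))
  exact hV.2 W hW hWup hd.closure_eq.symm.subset

/-- Minimal points of an L-compact space lie in its spatial part. -/
theorem IsMin.mem_spatialPart {X : Type*} [TopologicalSpace X] [PartialOrder X]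
    (hX : IsPriestley X) (hK : kerSet X univ = univ) {y : X} (hy : IsMin y) :
    y ∈ spatialPart X := by
  have hIic : Iic y = {y} := hy.Iic_eq
  have hcl : IsClosed ({y} : Set X) := hIic ▸ hX.isClosed_Iic y
  change IsClopen (Iic y)
  rw [hIic]
  refine ⟨hcl, ?_⟩
  by_contra hno
  have hup : IsUpperSet ({y}ᶜ : Set X) := by
    rw [← hIic]
    exact (isLowerSet_Iic y).compl
  have hd : Dense ({y}ᶜ : Set X) := dense_compl_singleton_iff_not_open.2 hno
  have h := eq_univ_of_dense_of_kerSet_eq_univ hK hcl.isOpen_compl hup hd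
  exact (h.symm.subset (mem_univ y)) rfl

theorem isUpperSet_cenSet {X : Type*} [TopologicalSpace X] [Preorder X] (U : Set X) :
    IsUpperSet (cenSet X U) :=
  isUpperSet_sUnion fun _ hV => hV.1.2.1

theorem isLowerSet_cenSet {X : Type*} [TopologicalSpace X] [Preorder X] (U : Set X) :
    IsLowerSet (cenSet X U) :=
  isLowerSet_sUnion fun _ hV => hV.1.2.2

theorem cenSet_subset {X : Type*} [TopologicalSpace X] [Preorder X] (U : Set X) :
    cenSet X U ⊆ U :=
  sUnion_subset fun _ hV => hV.2

/-- in a Stone L-space, clopen Scott upsets coincide with clopen bisets. -/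
theorem stmt14 {X : Type*} [TopologicalSpace X] [PartialOrder X]
    (hX : IsLSpace X) (hK : kerSet X Set.univ = Set.univ)
    (hcen : ∀ U ∈ ClopUp X, U ⊆ closure (cenSet X U)) :
    ClopSUp X = ClopBi X := by
  have hP : IsPriestley X := hX.1.1
  ext U
  constructor
  · rintro ⟨hU, hS⟩
    have h : U ⊆ cenSet X U :=
      hS.subset_of_subset_closure hP (isUpperSet_cenSet U) (hcen U ⟨hU, hS.2.1⟩)
    have hlow : IsLowerSet U := h.antisymm (cenSet_subset U) ▸ isLowerSet_cenSet U
    exact ⟨hU, hS.2.1, hlow⟩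
  · rintro ⟨hU, hup, hlow⟩
    refine ⟨hU, hU.isClosed, hup, fun y hy hmin => IsMin.mem_spatialPart hP hK fun z hz => ?_⟩
    exact (hmin z (hlow hz hy) hz).ge
end

section
/- Every Stone L-space is a coherent L-space: if X is an L-compact L-space such that cen U is dense in U for every clopen upset U, then X is an algebraic L-space (core U is dense in U for every clopen upset U) and X is kernel-stable (ker(U ∩ V) = ker U ∩ ker V for all clopen upsets U, V). -/
open Set Topology

section LSpaceLemmas

variable {X : Type*} [TopologicalSpace X]

/-- Points of a Priestley space are closed. -/
theorem IsPriestley.isClosed_singleton [PartialOrder X] (hX : IsPriestley X) (x : X) :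
    IsClosed ({x} : Set X) := by
  rw [← isOpen_compl_iff, isOpen_iff_forall_mem_open]
  intro y hy
  by_cases h : y ≤ x
  · obtain ⟨U, hU, hxU, hyU⟩ := hX.2 x y fun h' => hy (le_antisymm h h')
    exact ⟨Uᶜ, fun z hz hzx => hz (hzx ▸ hxU), hU.1.1.isOpen_compl, hyU⟩
  · obtain ⟨U, hU, hyU, hxU⟩ := hX.2 y x h
    exact ⟨U, fun z hz hzx => hxU (hzx ▸ hz), hU.1.2, hyU⟩

/-- In an L-compact space, the only dense open upset is the whole space. -/
theorem eq_univ_of_dense_of_kerSet_univ [Preorder X] (hK : kerSet X univ = univ) {W : Set X}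
    (hWo : IsOpen W) (hWu : IsUpperSet W) (hW : Dense W) : W = univ := by
  refine eq_univ_of_forall fun x => ?_
  obtain ⟨V, ⟨-, hV⟩, hxV⟩ := hK.symm ▸ mem_univ x
  exact hV W hWo hWu hW.closure_eq.ge hxV

/-- In an L-compact Priestley space, clopen bisets are Scott upsets. -/
theorem clopBi_subset_clopSUp [PartialOrder X] (hX : IsPriestley X)
    (hK : kerSet X univ = univ) : ClopBi X ⊆ ClopSUp X := by
  rintro B ⟨hBc, hBu, hBl⟩
  refine ⟨hBc, hBc.1, hBu, fun y hy hmin => ?_⟩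
  have hIic : {x : X | x ≤ y} = {y} :=
    Subset.antisymm (fun z hz => hmin z (hBl hz hy) hz) (singleton_subset_iff.2 le_rfl)
  change IsClopen {x : X | x ≤ y}
  have hcl := hX.isClosed_singleton y
  refine hIic.symm ▸ ⟨hcl, ?_⟩
  by_contra hopen
  have hup : IsUpperSet ({y}ᶜ : Set X) := hIic ▸ (isLowerSet_Iic y).compl
  have hW := eq_univ_of_dense_of_kerSet_univ hK hcl.isOpen_compl hup
    (dense_compl_singleton_iff_not_open.2 hopen)
  exact (hW.symm ▸ mem_univ y : y ∈ ({y}ᶜ : Set X)) rfl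

/-- In an L-compact space, every clopen biset is way below itself. -/
theorem wayBelowSet_self_of_mem_clopBi [Preorder X] (hK : kerSet X univ = univ) {E : Set X}
    (hE : E ∈ ClopBi X) : wayBelowSet X E E := by
  intro W hWo hWu hEW x hx
  have h := eq_univ_of_dense_of_kerSet_univ hK (hWo.union hE.1.compl.2) (hWu.union hE.2.2.compl)
    fun z => by
      by_cases hz : z ∈ E
      · exact closure_mono subset_union_left (hEW hz)
      · exact subset_closure (Or.inr hz)
  exact (h.symm ▸ mem_univ x : x ∈ W ∪ Eᶜ).resolve_right fun hx' => hx' hx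

theorem wayBelowSet.mono_right [Preorder X] {A U V : Set X} (h : wayBelowSet X A U)
    (hUV : U ⊆ V) : wayBelowSet X A V :=
  fun W hWo hWu hVW => h W hWo hWu (hUV.trans hVW)

theorem wayBelowSet.subset_cenSet [Preorder X] {A U : Set X} (h : wayBelowSet X A U)
    (hU : U ⊆ closure (cenSet X U)) : A ⊆ cenSet X U :=
  h _ (isOpen_sUnion fun _ hV => hV.1.1.2) (isUpperSet_sUnion fun _ hV => hV.1.2.1) hU

end LSpaceLemmas

/-- every Stone L-space is a coherent L-space (algebraic and kernel-stable). -/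
theorem stmt16 {X : Type*} [TopologicalSpace X] [PartialOrder X]
    (hX : IsLSpace X) (hK : kerSet X Set.univ = Set.univ)
    (hcen : ∀ U ∈ ClopUp X, U ⊆ closure (cenSet X U)) :
    (∀ U ∈ ClopUp X, U ⊆ closure (coreSet X U)) ∧
      ∀ U ∈ ClopUp X, ∀ V ∈ ClopUp X, kerSet X (U ∩ V) = kerSet X U ∩ kerSet X V := by
  refine ⟨fun U hU => (hcen U hU).trans (closure_mono (sUnion_subset_sUnion fun B hB =>
    ⟨clopBi_subset_clopSUp hX.1.1 hK hB.1, hB.2⟩)), fun U hU V hV => ?_⟩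
  apply Subset.antisymm
  · rintro x ⟨A, ⟨hA, hAUV⟩, hxA⟩
    exact ⟨⟨A, ⟨hA, hAUV.mono_right inter_subset_left⟩, hxA⟩,
      ⟨A, ⟨hA, hAUV.mono_right inter_subset_right⟩, hxA⟩⟩
  · rintro x ⟨⟨A, ⟨-, hAU⟩, hxA⟩, ⟨B, ⟨-, hBV⟩, hxB⟩⟩
    obtain ⟨C, ⟨hC, hCU⟩, hxC⟩ := hAU.subset_cenSet (hcen U hU) hxA
    obtain ⟨D, ⟨hD, hDV⟩, hxD⟩ := hBV.subset_cenSet (hcen V hV) hxB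
    have hE : C ∩ D ∈ ClopBi X :=
      ⟨hC.1.inter hD.1, hC.2.1.inter hD.2.1, hC.2.2.inter hD.2.2⟩
    exact ⟨C ∩ D, ⟨⟨hE.1, hE.2.1⟩, (wayBelowSet_self_of_mem_clopBi hK hE).mono_right
      (inter_subset_inter hCU hDV)⟩, hxC, hxD⟩
end

section
/- Let X be an SL-space with spatial part Y. Then X is a zero-dimensional L-space if and only if Y is a zero-dimensional topological space (i.e., the topology on Y has a basis of clopen sets). -/
open Set Topology

theorem IsPriestley.t2Space_and_totallyDisconnectedSpace {X : Type*} [TopologicalSpace X]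
    [PartialOrder X] (hX : IsPriestley X) : T2Space X ∧ TotallyDisconnectedSpace X := by
  have hsep : TotallySeparatedSpace X := by
    refine totallySeparatedSpace_iff_exists_isClopen.mpr fun x y hxy => ?_
    by_cases h : x ≤ y
    · obtain ⟨U, hU, hy, hx⟩ := hX.2 y x fun h' => hxy (le_antisymm h h')
      exact ⟨Uᶜ, hU.1.compl, hx, fun h' => h' hy⟩
    · obtain ⟨U, hU, hx, hy⟩ := hX.2 x y h
      exact ⟨U, hU.1, hx, hy⟩
  exact ⟨inferInstance, inferInstance⟩

theorem IsEsakia.isUpperSet_closure {X : Type*} [TopologicalSpace X] [PartialOrder X]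
    (hX : IsEsakia X) {O : Set X} (hO : IsUpperSet O) : IsUpperSet (closure O) := by
  obtain ⟨_, _⟩ := hX.1.t2Space_and_totallyDisconnectedSpace
  have := hX.1.1
  intro x z hxz hx
  rw [(isTopologicalBasis_isClopen (X := X)).mem_closure_iff]
  intro N hN hz
  obtain ⟨o, ⟨n, hn, hon⟩, ho⟩ :=
    mem_closure_iff.mp hx _ (hX.2 N hN).isOpen ⟨z, hz, hxz⟩
  exact ⟨n, hn, hO hon ho⟩

theorem mem_of_mem_closure_of_mem_spatialPart {X : Type*} [TopologicalSpace X] [Preorder X]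
    {O : Set X} (hO : IsUpperSet O) {y : X} (hy : y ∈ spatialPart X) (h : y ∈ closure O) :
    y ∈ O := by
  obtain ⟨o, hoy, ho⟩ := mem_closure_iff.mp h {x | x ≤ y} hy.isOpen le_rfl
  exact hO hoy ho

theorem IsLSpace.isOpen_spatialTop_iff {X : Type*} [TopologicalSpace X] [PartialOrder X]
    (hX : IsLSpace X) {V : Set (spatialPart X)} :
    IsOpen[spatialTop X] V ↔ ∃ U ∈ ClopUp X, V = ((↑) : spatialPart X → X) ⁻¹' U := by
  refine ⟨fun h => ?_, fun h => TopologicalSpace.GenerateOpen.basic _ h⟩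
  induction h with
  | basic s hs => exact hs
  | univ => exact ⟨univ, ⟨isClopen_univ, isUpperSet_univ⟩, rfl⟩
  | inter s t _ _ hs ht =>
    obtain ⟨U, hU, rfl⟩ := hs
    obtain ⟨W, hW, rfl⟩ := ht
    exact ⟨U ∩ W, ⟨hU.1.inter hW.1, hU.2.inter hW.2⟩, rfl⟩
  | sUnion S _ ih =>
    set O : Set X := ⋃₀ {U | U ∈ ClopUp X ∧ ((↑) : spatialPart X → X) ⁻¹' U ∈ S}
    have hOo : IsOpen O := isOpen_sUnion fun U hU => hU.1.1.isOpen
    have hOu : IsUpperSet O := isUpperSet_sUnion fun U hU => hU.1.2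
    refine ⟨closure O, ⟨⟨isClosed_closure, hX.2 O hOo hOu⟩, hX.1.isUpperSet_closure hOu⟩, ?_⟩
    ext y
    constructor
    · rintro ⟨s, hs, hy⟩
      obtain ⟨U, hU, rfl⟩ := ih s hs
      exact subset_closure ⟨U, ⟨hU, hs⟩, hy⟩
    · intro hy
      obtain ⟨U, hU, hyU⟩ := mem_of_mem_closure_of_mem_spatialPart hOu y.2 hy
      exact ⟨_, hU.2, hyU⟩

theorem Dense.subset_of_inter_subset_of_isOpen_of_isClosed {X : Type*} [TopologicalSpace X]
    {D A B : Set X} (hD : Dense D) (hA : IsOpen A) (hB : IsClosed B) (h : A ∩ D ⊆ B) : A ⊆ B :=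
  (hD.open_subset_closure_inter hA).trans (closure_minimal h hB)

/-- an SL-space is a zero-dimensional L-space iff its spatial part
is a zero-dimensional topological space. -/
theorem stmt17 {X : Type*} [TopologicalSpace X] [PartialOrder X]
    (hX : IsLSpace X) (hSL : Dense (spatialPart X)) :
    (∀ U ∈ ClopUp X, U ⊆ closure (cenSet X U)) ↔
      ∀ V : Set (spatialPart X), IsOpen[spatialTop X] V → ∀ y ∈ V,
        ∃ C : Set (spatialPart X), @IsClopen _ (spatialTop X) C ∧ y ∈ C ∧ C ⊆ V := by
  constructor
  · intro h V hV y hy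
    obtain ⟨U, hU, rfl⟩ := hX.isOpen_spatialTop_iff.mp hV
    have hcen : IsUpperSet (cenSet X U) := isUpperSet_sUnion fun B hB => hB.1.2.1
    obtain ⟨B, ⟨⟨hBc, hBu, hBl⟩, hBU⟩, hyB⟩ :=
      mem_of_mem_closure_of_mem_spatialPart hcen y.2 (h U hU hy)
    refine ⟨((↑) : spatialPart X → X) ⁻¹' B, ⟨@IsClosed.mk _ (spatialTop X) _ ?_, ?_⟩, hyB,
      preimage_mono hBU⟩
    · exact hX.isOpen_spatialTop_iff.mpr ⟨Bᶜ, ⟨hBc.compl, hBl.compl⟩, rfl⟩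
    · exact hX.isOpen_spatialTop_iff.mpr ⟨B, ⟨hBc, hBu⟩, rfl⟩
  · intro h U hU
    refine (hSL.open_subset_closure_inter hU.1.isOpen).trans (closure_mono ?_)
    rintro y ⟨hyU, hy⟩
    obtain ⟨C, hC, hyC, hCU⟩ :=
      h _ (hX.isOpen_spatialTop_iff.mpr ⟨U, hU, rfl⟩) ⟨y, hy⟩ hyU
    obtain ⟨A, hA, rfl⟩ := hX.isOpen_spatialTop_iff.mp hC.2
    obtain ⟨B, hB, hAB⟩ := hX.isOpen_spatialTop_iff.mp hC.1.isOpen_compl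
    have key : ∀ z ∈ spatialPart X, z ∉ A ↔ z ∈ B := fun z hz => Set.ext_iff.mp hAB ⟨z, hz⟩
    have hABc : A = Bᶜ := by
      apply Subset.antisymm
      · exact hSL.subset_of_inter_subset_of_isOpen_of_isClosed hA.1.isOpen hB.1.compl.isClosed
          fun z hz hzB => (key z hz.2).mpr hzB hz.1
      · exact hSL.subset_of_inter_subset_of_isOpen_of_isClosed hB.1.compl.isOpen hA.1.isClosed
          fun z hz => by_contra fun hzA => hz.1 ((key z hz.2).mp hzA)
    refine ⟨A, ⟨⟨hA.1, hA.2, hABc ▸ hB.2.compl⟩, ?_⟩, hyC⟩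
    exact hSL.subset_of_inter_subset_of_isOpen_of_isClosed hA.1.isOpen hU.1.isClosed
      fun z hz => hCU (a := ⟨z, hz.2⟩) hz.1
end

section
/- Let X be a topological space whose topology has a basis of compact open sets. Then every compact saturated subset K of X equals the intersection of the compact open sets containing it; in particular, for every x ∉ K there is a compact open set U with K ⊆ U and x ∉ U. -/
open Set Topology

/-- In a compactly based space, a compact open set fits between a compact set and any open set
containing it. -/
theorem CompactlyBased.exists_isCompact_isOpen_between {X : Type*} [TopologicalSpace X]
    (hcb : CompactlyBased X) {K V : Set X} (hK : IsCompact K) (hV : IsOpen V) (hKV : K ⊆ V) :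
    ∃ U : Set X, IsCompact U ∧ IsOpen U ∧ K ⊆ U ∧ U ⊆ V := by
  choose! B hBo hBc hyB hBV using hcb V hV
  obtain ⟨t, htK, hKt⟩ := hK.elim_nhds_subcover B
    fun y hy => (hBo y (hKV hy)).mem_nhds (hyB y (hKV hy))
  exact ⟨⋃ y ∈ t, B y, t.isCompact_biUnion fun y hy => hBc y (hKV (htK y hy)),
    isOpen_biUnion fun y hy => hBo y (hKV (htK y hy)), hKt,
    iUnion₂_subset fun y hy => hBV y (hKV (htK y hy))⟩

/-- in a compactly based space, every compact saturated set is the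
intersection of the compact open sets containing it. -/
theorem stmt18 (X : Type*) [TopologicalSpace X] (hcb : CompactlyBased X)
    (K : Set X) (hK : IsCompact K) (hsat : IsSaturatedSet K) :
    K = ⋂₀ {U : Set X | IsCompact U ∧ IsOpen U ∧ K ⊆ U} ∧
      ∀ x ∉ K, ∃ U : Set X, IsCompact U ∧ IsOpen U ∧ K ⊆ U ∧ x ∉ U := by
  have separate : ∀ x ∉ K, ∃ U : Set X, IsCompact U ∧ IsOpen U ∧ K ⊆ U ∧ x ∉ U := by
    intro x hx
    rw [hsat] at hx
    simp only [mem_sInter, mem_ofPred_eq, not_forall] at hx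
    obtain ⟨V, ⟨hV, hKV⟩, hxV⟩ := hx
    obtain ⟨U, hUc, hUo, hKU, hUV⟩ := hcb.exists_isCompact_isOpen_between hK hV hKV
    exact ⟨U, hUc, hUo, hKU, fun h => hxV (hUV h)⟩
  refine ⟨Subset.antisymm (subset_sInter fun U hU => hU.2.2) fun x hx => ?_, separate⟩
  by_contra hxK
  obtain ⟨U, hUc, hUo, hKU, hxU⟩ := separate x hxK
  exact hxU (hx U ⟨hUc, hUo, hKU⟩)
end
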